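/- arXiv:2304.13482 — 8 statements merged into one kernel-verified Lean document; each statement's English description precedes it below -/
import Mathlib

section
/- Let φ : A → ℂ be a linear functional that is self-adjoint (φ(star a) = conj(φ a) for all a) and faithful in the strong sense that, for y ∈ A, if φ(x * y) = 0 for all x ∈ A then y = 0. Let σ be an algebra automorphism of A satisfying φ(a * b) = φ(b * σ a) for all a, b ∈ A. Then σ(star a) = star(σ⁻¹ a) for all a ∈ A. -/
theorem stmt3 (A : Type*) [Ring A] [Algebra ℂ A] [StarRing A] [StarModule ℂ A]
    (φ : A →ₗ[ℂ] ℂ)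
    (hφsa : ∀ a : A, φ (star a) = starRingEnd ℂ (φ a))
    (hfaith : ∀ y : A, (∀ x : A, φ (x * y) = 0) → y = 0)
    (σ : A ≃ₐ[ℂ] A)
    (hmod : ∀ a b : A, φ (a * b) = φ (b * σ a)) :
    ∀ a : A, σ (star a) = star (σ.symm a) := by
  intro a
  refine sub_eq_zero.mp (hfaith _ fun x => ?_)
  have h₁ : φ (star a * x) = starRingEnd ℂ (φ (star x * a)) := by
    rw [← hφsa, star_mul, star_star]
  have h₂ : φ (x * star (σ.symm a)) = starRingEnd ℂ (φ (σ.symm a * star x)) := by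
    rw [← hφsa, star_mul, star_star]
  rw [mul_sub, map_sub, ← hmod, h₁, h₂, hmod (σ.symm a), AlgEquiv.apply_symm_apply, sub_self]
end

section
/- Let φ : A → ℂ be a positive faithful linear functional and δ a unit of A with star δ = δ. Assume: (1) for every a ∈ A there exists c ∈ A with star a * δ * a = star c * c; (2) for every a ∈ A, the ℂ-linear spans of {δ^n * a : n ∈ ℤ} and of {a * δ^n : n ∈ ℤ} are finite-dimensional (integer powers of δ taken in the group of units). Then every a ∈ A is a finite sum of elements x ∈ A for which there exist real numbers λ > 0 and μ > 0 with δ * x = λ • x and x * δ = μ • x. -/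
open scoped ComplexOrder

/-- A positive linear functional on a unital *-algebra is hermitian. -/
theorem map_star_of_nonneg_star_mul_self {A : Type*} [Ring A] [Algebra ℂ A] [StarRing A]
    [StarModule ℂ A] (φ : A →ₗ[ℂ] ℂ) (hpos : ∀ a : A, 0 ≤ φ (star a * a)) (a : A) :
    φ (star a) = star (φ a) := by
  have e0 := (Complex.le_def.1 (hpos 1)).2
  have e1 := (Complex.le_def.1 (hpos a)).2
  have e2 := (Complex.le_def.1 (hpos (1 + a))).2
  have e3 := (Complex.le_def.1 (hpos (1 + Complex.I • a))).2
  simp only [star_add, star_one, star_smul, mul_add, add_mul, one_mul, mul_one, map_add,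
    smul_mul_assoc, mul_smul_comm, map_smul, Complex.add_im, smul_eq_mul, Complex.mul_im,
    Complex.mul_re, Complex.I_re, Complex.I_im, RCLike.star_def, Complex.conj_re,
    Complex.conj_im, Complex.zero_im] at e0 e1 e2 e3
  apply Complex.ext
  · simp only [RCLike.star_def, Complex.conj_re]
    linarith
  · simp only [RCLike.star_def, Complex.conj_im]
    linarith

/-- An injective symmetric operator with nonnegative quadratic form on a finite-dimensional
inner product space has a spanning set of eigenvectors with positive eigenvalues. -/
theorem LinearMap.IsSymmetric.mem_span_pos_eigenvectors {V : Type*} [NormedAddCommGroup V]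
    [InnerProductSpace ℂ V] [FiniteDimensional ℂ V] {T : V →ₗ[ℂ] V} (hT : T.IsSymmetric)
    (hpos : ∀ x, 0 ≤ inner ℂ x (T x)) (hinj : Function.Injective T) (v : V) :
    v ∈ Submodule.span ℂ {x : V | ∃ r : ℝ, 0 < r ∧ T x = (r : ℂ) • x} := by
  have hv : v ∈ Submodule.span ℂ (Set.range (hT.eigenvectorBasis rfl)) := by
    rw [← OrthonormalBasis.coe_toBasis, Module.Basis.span_eq]
    trivial
  refine Submodule.span_mono ?_ hv
  rintro _ ⟨i, rfl⟩
  have hi := hT.apply_eigenvectorBasis rfl i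
  refine ⟨hT.eigenvalues rfl i, lt_of_le_of_ne ?_ ?_, hi⟩
  · have h := hpos (hT.eigenvectorBasis rfl i)
    rw [hi, inner_smul_right, inner_self_eq_norm_sq_to_K,
      (hT.eigenvectorBasis rfl).orthonormal.1 i] at h
    simpa using h
  · intro h0
    rw [← h0] at hi
    have hz : hT.eigenvectorBasis rfl i = 0 := hinj (by simpa using hi)
    have h1 := (hT.eigenvectorBasis rfl).orthonormal.1 i
    simp [hz] at h1

/-- Left multiplication by a positive unit decomposes every element with finite-dimensional orbit
into eigenvectors, which lie in the span of the orbit. -/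
theorem mem_span_pos_left_eigenvectors {A : Type*} [Ring A] [Algebra ℂ A] [StarRing A]
    [StarModule ℂ A] (φ : A →ₗ[ℂ] ℂ)
    (hpos : ∀ a : A, 0 ≤ φ (star a * a))
    (hfaith : ∀ a : A, φ (star a * a) = 0 → a = 0)
    (δ : Aˣ) (hδstar : star (δ : A) = (δ : A))
    (h1 : ∀ a : A, ∃ c : A, star a * (δ : A) * a = star c * c) (a : A)
    (hfin : FiniteDimensional ℂ
      (Submodule.span ℂ (Set.range fun n : ℤ => ((δ ^ n : Aˣ) : A) * a))) :
    a ∈ Submodule.span ℂ {x : A |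
      x ∈ Submodule.span ℂ (Set.range fun n : ℤ => ((δ ^ n : Aˣ) : A) * a) ∧
      ∃ r : ℝ, 0 < r ∧ (δ : A) * x = (r : ℂ) • x} := by
  set V := Submodule.span ℂ (Set.range fun n : ℤ => ((δ ^ n : Aˣ) : A) * a)
  have hinv : ∀ x ∈ V, LinearMap.mulLeft ℂ (δ : A) x ∈ V := by
    suffices V ≤ V.comap (LinearMap.mulLeft ℂ (δ : A)) from this
    refine Submodule.span_le.2 ?_
    rintro _ ⟨n, rfl⟩
    refine Submodule.subset_span ⟨n + 1, ?_⟩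
    simp only [LinearMap.mulLeft_apply, ← mul_assoc, ← Units.val_mul]
    rw [add_comm, zpow_add, zpow_one]
  have haV : a ∈ V := Submodule.subset_span ⟨0, by simp⟩
  let c : InnerProductSpace.Core ℂ V :=
    { inner := fun x y => φ (star (x : A) * y)
      conj_inner_symm := fun x y => by
        have h := map_star_of_nonneg_star_mul_self φ hpos (star (y : A) * x)
        rw [star_mul, star_star] at h
        exact h.symm
      re_inner_nonneg := fun x => (Complex.le_def.1 (hpos x)).1
      add_left := fun x y z => by simp [add_mul]
      smul_left := fun x y r => by simp
      definite := fun x hx => Subtype.ext (hfaith x hx) }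
  let _ : NormedAddCommGroup V := c.toNormedAddCommGroup
  let _ : InnerProductSpace ℂ V := InnerProductSpace.ofCore c.toCore
  have hinner : ∀ x y : V, inner ℂ x y = φ (star (x : A) * y) := fun _ _ => rfl
  let T : V →ₗ[ℂ] V := (LinearMap.mulLeft ℂ (δ : A)).restrict hinv
  have hTval : ∀ x : V, ((T x : V) : A) = (δ : A) * x := fun _ => rfl
  have hT : T.IsSymmetric := fun x y => by
    rw [hinner, hinner, hTval, hTval, star_mul, hδstar, mul_assoc]
  have hTpos : ∀ x, 0 ≤ inner ℂ x (T x) := fun x => by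
    obtain ⟨d, hd⟩ := h1 x
    rw [hinner, hTval, ← mul_assoc, hd]
    exact hpos d
  have hTinj : Function.Injective T := fun x y hxy => by
    have h := congrArg Subtype.val hxy
    rw [hTval, hTval] at h
    exact Subtype.ext (δ.mul_right_inj.1 h)
  have key := Submodule.mem_map_of_mem (f := V.subtype)
    (hT.mem_span_pos_eigenvectors hTpos hTinj ⟨a, haV⟩)
  rw [Submodule.map_span] at key
  refine Submodule.span_mono ?_ key
  rintro _ ⟨x, ⟨r, hr, hx⟩, rfl⟩
  exact ⟨x.2, r, hr, congrArg Subtype.val hx⟩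

theorem stmt6 (A : Type*) [Ring A] [Algebra ℂ A] [StarRing A] [StarModule ℂ A]
    (φ : A →ₗ[ℂ] ℂ)
    (hpos : ∀ a : A, 0 ≤ φ (star a * a))
    (hfaith : ∀ a : A, φ (star a * a) = 0 → a = 0)
    (δ : Aˣ) (hδstar : star ((δ : A)) = (δ : A))
    (h1 : ∀ a : A, ∃ c : A, star a * (δ : A) * a = star c * c)
    (h2 : ∀ a : A,
      FiniteDimensional ℂ (Submodule.span ℂ (Set.range fun n : ℤ => ((δ ^ n : Aˣ) : A) * a)) ∧
      FiniteDimensional ℂ (Submodule.span ℂ (Set.range fun n : ℤ => a * ((δ ^ n : Aˣ) : A)))) :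
    ∀ a : A, a ∈ Submodule.span ℂ
      {x : A | ∃ lam mu : ℝ, 0 < lam ∧ 0 < mu ∧
        (δ : A) * x = (lam : ℂ) • x ∧ x * (δ : A) = (mu : ℂ) • x} := by
  have left := fun a => mem_span_pos_left_eigenvectors φ hpos hfaith δ hδstar h1 a (h2 a).1
  intro a
  refine Submodule.span_le.2 ?_ (left a)
  rintro b ⟨-, lam, hlam, hb⟩
  have hbstar : star b * (δ : A) = (lam : ℂ) • star b := by
    have h := congrArg star hb
    simpa [hδstar] using h
  have key := Submodule.mem_map_of_mem (f := (starLinearEquiv ℂ (A := A)).toLinearMap)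
    (left (star b))
  rw [Submodule.map_span] at key
  simp only [LinearEquiv.coe_coe, starLinearEquiv_apply, star_star] at key
  refine Submodule.span_mono ?_ key
  rintro _ ⟨x, ⟨hxV, mu, hmu, hx⟩, rfl⟩
  have hxr : x * (δ : A) = (lam : ℂ) • x := by
    suffices hle : Submodule.span ℂ (Set.range fun n : ℤ => ((δ ^ n : Aˣ) : A) * star b) ≤
        LinearMap.eqLocus (LinearMap.mulRight ℂ (δ : A)) ((lam : ℂ) • LinearMap.id) from hle hxV
    refine Submodule.span_le.2 ?_
    rintro _ ⟨n, rfl⟩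
    simp [LinearMap.mem_eqLocus, mul_assoc, hbstar]
  refine ⟨lam, mu, hlam, hmu, ?_, ?_⟩
  · simpa [hδstar] using congrArg star hxr
  · simpa [hδstar] using congrArg star hx
end

section
/- Let φ : A → ℂ be a positive faithful linear functional, σ an algebra automorphism of A with φ(a * b) = φ(b * σ a) for all a, b ∈ A, and δ ∈ A with star δ = δ. Suppose σ δ = τ⁻¹ • δ for some τ ∈ ℂ, τ ≠ 0, and suppose there exist a ∈ A with a ≠ 0 and a real number λ > 0 such that δ * a = λ • a. Then τ = 1. -/
open scoped ComplexOrder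

theorem stmt7 (A : Type*) [Ring A] [Algebra ℂ A] [StarRing A] [StarModule ℂ A]
    (φ : A →ₗ[ℂ] ℂ)
    (hpos : ∀ a : A, 0 ≤ φ (star a * a))
    (hfaith : ∀ a : A, φ (star a * a) = 0 → a = 0)
    (σ : A ≃ₐ[ℂ] A) (hmod : ∀ a b : A, φ (a * b) = φ (b * σ a))
    (δ : A) (hδstar : star δ = δ)
    (τ : ℂ) (hτ : τ ≠ 0) (hσδ : σ δ = τ⁻¹ • δ)
    (hex : ∃ (a : A) (lam : ℝ), a ≠ 0 ∧ 0 < lam ∧ δ * a = (lam : ℂ) • a) :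
    τ = 1 := by
  obtain ⟨a, lam, ha, hlam, hδa⟩ := hex
  have hb : φ (a * star a) ≠ 0 := fun h =>
    ha (star_eq_zero.mp (hfaith (star a) (by rwa [star_star])))
  have hleft : δ * (a * star a) = (lam : ℂ) • (a * star a) := by
    rw [← mul_assoc, hδa, smul_mul_assoc]
  have hright : a * star a * δ = (lam : ℂ) • (a * star a) := by
    have h := congrArg star hleft
    rwa [star_mul, star_smul, star_mul, star_star, hδstar, Complex.star_def,
      Complex.conj_ofReal] at h
  have h := hmod δ (a * star a)
  rw [hσδ, mul_smul_comm, hleft, hright, map_smul, map_smul, map_smul, smul_eq_mul,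
    smul_eq_mul] at h
  have hlam' : (lam : ℂ) * φ (a * star a) ≠ 0 :=
    mul_ne_zero (Complex.ofReal_ne_zero.mpr hlam.ne') hb
  exact inv_eq_one.mp (mul_right_cancel₀ hlam' (by rw [one_mul, ← h]))
end

section
/- Let φ : A → ℂ be a positive faithful linear functional, σ an algebra automorphism of A with φ(a * b) = φ(b * σ a) for all a, b ∈ A, and δ ∈ A with star δ = δ and σ δ = δ. Suppose S : A → A is a linear map with φ(S a) = φ(a * δ) for all a ∈ A, and suppose every element of A is a finite sum of elements x ∈ A satisfying x * δ = λ • x for some real number λ > 0 (depending on x). Then φ ∘ S is positive: for every a ∈ A, φ(S(star a * a)) is a nonnegative real number. -/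
open scoped ComplexOrder

/-- If right multiplication by `δ` is symmetric for the form `(x, y) ↦ φ (star x * y)`, then its
eigenvectors for distinct real eigenvalues are orthogonal; in the form needed to rescale
eigenvectors by square roots of the eigenvalues. -/
theorem sqrt_mul_sqrt_mul_form {A : Type*} [Ring A] [Algebra ℂ A] [StarRing A] [StarModule ℂ A]
    (φ : A →ₗ[ℂ] ℂ) {δ : A} (hδstar : star δ = δ) (hcomm : ∀ b : A, φ (δ * b) = φ (b * δ))
    {x y : A} {r s : ℝ} (hr : 0 < r) (hx : x * δ = (r : ℂ) • x) (hy : y * δ = (s : ℂ) • y) :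
    ((√r : ℝ) : ℂ) * ((√s : ℝ) : ℂ) * φ (star x * y) = φ (star x * y * δ) := by
  have h₁ : φ (star x * y * δ) = s * φ (star x * y) := by
    rw [mul_assoc, hy, mul_smul_comm, map_smul, smul_eq_mul]
  have h₂ : φ (star x * y * δ) = r * φ (star x * y) := by
    have hδx : δ * star x = (r : ℂ) • star x := by
      simpa [hδstar, star_smul] using congrArg star hx
    rw [← hcomm, ← mul_assoc, hδx, smul_mul_assoc, map_smul, smul_eq_mul]
  by_cases h : φ (star x * y) = 0
  · simp [h₁, h]
  · have hrs : r = s := by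
      exact_mod_cast mul_right_cancel₀ h (h₂.symm.trans h₁)
    subst hrs
    rw [h₁, ← Complex.ofReal_mul, Real.mul_self_sqrt hr.le]

theorem stmt8 (A : Type*) [Ring A] [Algebra ℂ A] [StarRing A] [StarModule ℂ A]
    (φ : A →ₗ[ℂ] ℂ)
    (hpos : ∀ a : A, 0 ≤ φ (star a * a))
    (hfaith : ∀ a : A, φ (star a * a) = 0 → a = 0)
    (σ : A ≃ₐ[ℂ] A) (hmod : ∀ a b : A, φ (a * b) = φ (b * σ a))
    (δ : A) (hδstar : star δ = δ) (hσδ : σ δ = δ)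
    (S : A →ₗ[ℂ] A) (hS : ∀ a : A, φ (S a) = φ (a * δ))
    (hdec : ∀ a : A, a ∈ Submodule.span ℂ
      {x : A | ∃ lam : ℝ, 0 < lam ∧ x * δ = (lam : ℂ) • x}) :
    ∀ a : A, 0 ≤ φ (S (star a * a)) := by
  intro a
  have hcomm : ∀ b : A, φ (δ * b) = φ (b * δ) := fun b => by rw [hmod, hσδ]
  obtain ⟨n, f, g, rfl⟩ := Submodule.mem_span_set'.mp (hdec a)
  choose r hr hg using fun i => (g i).2
  have hy : ∀ i, (f i • (g i : A)) * δ = (r i : ℂ) • (f i • (g i : A)) := fun i => by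
    rw [smul_mul_assoc, hg, smul_comm]
  have key := hpos (∑ i, ((√(r i) : ℝ) : ℂ) • (f i • (g i : A)))
  convert key using 1
  rw [hS]
  simp only [star_sum, Finset.sum_mul, Finset.mul_sum, map_sum]
  refine Finset.sum_congr rfl fun i _ => Finset.sum_congr rfl fun j _ => ?_
  rw [← sqrt_mul_sqrt_mul_form φ hδstar hcomm (hr _) (hy _) (hy _)]
  rw [star_smul (Complex.ofReal _), smul_mul_smul_comm, map_smul, smul_eq_mul, Complex.star_def,
    Complex.conj_ofReal]
end

section
/- Let ψ : A → ℂ be a positive right integral, and assume that the set {(x ⊗ 1) * Δ(y) : x, y ∈ A} spans A ⊗[ℂ] A. Then for every a ∈ A there exists a constant C ≥ 0 such that for all x ∈ A, (ψ(star(a * x) * (a * x))).re ≤ C * (ψ(star x * x)).re. -/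
open scoped TensorProduct
open TensorProduct
open scoped ComplexOrder

/-- The factorwise star on `A ⊗[ℂ] A`, as an additive map. -/
noncomputable def tensorStar (A : Type*) [Ring A] [Algebra ℂ A] [StarRing A] [StarModule ℂ A] :
    A ⊗[ℂ] A →+ A ⊗[ℂ] A :=
  TensorProduct.liftAddHom
    (AddMonoidHom.mk' (fun x => AddMonoidHom.mk' (fun y => star x ⊗ₜ[ℂ] star y)
        (fun y z => by simp [star_add, TensorProduct.tmul_add]))
      (fun x y => by ext z; simp [star_add, TensorProduct.add_tmul]))
    (fun c m n => by
      simp only [AddMonoidHom.mk'_apply, star_smul, TensorProduct.smul_tmul,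
        TensorProduct.tmul_smul, starRingEnd_apply])

/-- `(φ ⊗ id)` as a map `A ⊗[ℂ] A →ₗ[ℂ] A`. -/
noncomputable def lApply (A : Type*) [Ring A] [Algebra ℂ A] (φ : A →ₗ[ℂ] ℂ) :
    A ⊗[ℂ] A →ₗ[ℂ] A :=
  (TensorProduct.lid ℂ A).toLinearMap ∘ₗ TensorProduct.map φ LinearMap.id

/-- A linear functional is a right integral: `(ψ ⊗ id)(Δ a) = ψ(a) • 1`. -/
def IsRightIntegral (A : Type*) [Ring A] [Bialgebra ℂ A] (ψ : A →ₗ[ℂ] ℂ) : Prop :=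
  ∀ a : A, lApply A ψ (Coalgebra.comul (R := ℂ) a) = ψ a • (1 : A)

/-- A positive functional on a complex *-algebra is Hermitian. -/
theorem star_apply_star_mul {A : Type*} [Ring A] [Algebra ℂ A] [StarRing A] [StarModule ℂ A]
    {ψ : A →ₗ[ℂ] ℂ} (hpos : ∀ a : A, 0 ≤ ψ (star a * a)) (x y : A) :
    star (ψ (star x * y)) = ψ (star y * x) := by
  have h1 := (Complex.nonneg_iff.1 (hpos (x + y))).2
  have h2 := (Complex.nonneg_iff.1 (hpos (x + Complex.I • y))).2
  have hx := (Complex.nonneg_iff.1 (hpos x)).2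
  have hy := (Complex.nonneg_iff.1 (hpos y)).2
  simp only [star_add, star_smul, mul_add, add_mul, map_add, smul_mul_assoc, mul_smul_comm,
    map_smul, smul_eq_mul, Complex.add_im, Complex.mul_im, Complex.mul_re, Complex.star_def,
    Complex.conj_I, Complex.neg_re, Complex.neg_im, Complex.I_re, Complex.I_im] at h1 h2
  apply Complex.ext
  · simp only [Complex.star_def, Complex.conj_re]
    linarith
  · simp only [Complex.star_def, Complex.conj_im]
    linarith

/-- The positive semidefinite sesquilinear form `⟪x, y⟫ = ψ (star x * y)`. -/
noncomputable abbrev gnsCore {A : Type*} [Ring A] [Algebra ℂ A] [StarRing A] [StarModule ℂ A]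
    (ψ : A →ₗ[ℂ] ℂ) (hpos : ∀ a : A, 0 ≤ ψ (star a * a)) : PreInnerProductSpace.Core ℂ A where
  inner x y := ψ (star x * y)
  conj_inner_symm x y := star_apply_star_mul hpos y x
  re_inner_nonneg x := (Complex.nonneg_iff.1 (hpos x)).1
  add_left x y z := by simp [add_mul]
  smul_left x y r := by simp

/-- The Cauchy–Schwarz inequality for a positive functional. -/
theorem normSq_apply_star_mul_le {A : Type*} [Ring A] [Algebra ℂ A] [StarRing A]
    [StarModule ℂ A] {ψ : A →ₗ[ℂ] ℂ} (hpos : ∀ a : A, 0 ≤ ψ (star a * a)) (x y : A) :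
    star (ψ (star x * y)) * ψ (star x * y) ≤ ψ (star x * x) * ψ (star y * y) := by
  have h := @InnerProductSpace.Core.inner_mul_inner_self_le ℂ A _ _ _ (gnsCore ψ hpos) x y
  change ‖ψ (star x * y)‖ * ‖ψ (star y * x)‖ ≤ (ψ (star x * x)).re * (ψ (star y * y)).re at h
  rw [← star_apply_star_mul hpos x y, norm_star] at h
  have hre (a : A) : ((ψ (star a * a)).re : ℂ) = ψ (star a * a) :=
    Complex.ext rfl (Complex.nonneg_iff.1 (hpos a)).2
  rw [← hre x, ← hre y, Complex.star_def, Complex.conj_mul', sq]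
  exact_mod_cast h

/-- The sum of the entries of the Hadamard product of two positive semidefinite matrices is
nonnegative. -/
theorem Matrix.PosSemidef.sum_mul_nonneg {ι : Type*} [Fintype ι] {M N : Matrix ι ι ℂ}
    (hM : M.PosSemidef) (hN : N.PosSemidef) : 0 ≤ ∑ i, ∑ j, M i j * N i j := by
  have h := (hM.hadamard hN).dotProduct_mulVec_nonneg (fun _ => 1)
  simpa [dotProduct, Matrix.mulVec] using h

theorem apply_star_sum_mul_sum {A ι : Type*} [Fintype ι] [Ring A] [Algebra ℂ A] [StarRing A]
    [StarModule ℂ A] (ψ : A →ₗ[ℂ] ℂ) (v : ι → ℂ) (z : ι → A) :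
    ψ (star (∑ i, v i • z i) * ∑ i, v i • z i) =
      ∑ i, ∑ j, star (v i) * v j * ψ (star (z i) * z j) := by
  simp only [star_sum, star_smul, Finset.sum_mul_sum, map_sum, smul_mul_assoc, mul_smul_comm,
    map_smul, smul_eq_mul, mul_assoc, mul_left_comm]

theorem Matrix.star_dotProduct_mulVec_eq_sum {ι : Type*} [Fintype ι] (M : Matrix ι ι ℂ)
    (v : ι → ℂ) : star v ⬝ᵥ Matrix.mulVec M v = ∑ i, ∑ j, star (v i) * v j * M i j := by
  simp only [dotProduct, Matrix.mulVec, Finset.mul_sum, Pi.star_apply]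
  exact Finset.sum_congr rfl fun i _ => Finset.sum_congr rfl fun j _ => by ring

/-- Gram matrices of a positive functional are positive semidefinite. -/
theorem posSemidef_gram {A ι : Type*} [Fintype ι] [Ring A] [Algebra ℂ A] [StarRing A]
    [StarModule ℂ A] {ψ : A →ₗ[ℂ] ℂ} (hpos : ∀ a : A, 0 ≤ ψ (star a * a)) (z : ι → A) :
    (Matrix.of fun i j => ψ (star (z i) * z j)).PosSemidef := by
  refine .of_dotProduct_mulVec_nonneg ?_ fun v => ?_
  · ext i j
    exact star_apply_star_mul hpos _ _
  · rw [Matrix.star_dotProduct_mulVec_eq_sum]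
    exact (hpos (∑ i, v i • z i)).trans_eq (apply_star_sum_mul_sum ψ v z)

/-- Slicing the first leg against `c` is bounded for the tensor product of the forms. -/
theorem apply_sum_slice_le {A ι : Type*} [Fintype ι] [Ring A] [Algebra ℂ A] [StarRing A]
    [StarModule ℂ A] {ψ : A →ₗ[ℂ] ℂ} (hpos : ∀ a : A, 0 ≤ ψ (star a * a)) (c : A)
    (x z : ι → A) :
    ψ (star (∑ i, ψ (star c * x i) • z i) * ∑ i, ψ (star c * x i) • z i) ≤
      ψ (star c * c) * ∑ i, ∑ j, ψ (star (x i) * x j) * ψ (star (z i) * z j) := by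
  have hM : (Matrix.of fun i j => ψ (star c * c) * ψ (star (x i) * x j) -
      star (ψ (star c * x i)) * ψ (star c * x j)).PosSemidef := by
    refine .of_dotProduct_mulVec_nonneg ?_ fun v => ?_
    · ext i j
      simp only [Matrix.conjTranspose_apply, Matrix.of_apply, star_sub, star_mul',
        star_apply_star_mul hpos]
      ring
    · have h := sub_nonneg.2 (normSq_apply_star_mul_le hpos c (∑ i, v i • x i))
      refine h.trans_eq ?_
      rw [Matrix.star_dotProduct_mulVec_eq_sum, apply_star_sum_mul_sum,
        Finset.mul_sum _ _ (star c)]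
      simp only [mul_smul_comm, map_sum, map_smul, smul_eq_mul, star_sum, star_mul',
        Finset.sum_mul_sum]
      simp only [Finset.mul_sum, ← Finset.sum_sub_distrib, Matrix.of_apply]
      exact Finset.sum_congr rfl fun i _ => Finset.sum_congr rfl fun j _ => by ring
  have h := hM.sum_mul_nonneg (posSemidef_gram hpos z)
  rw [← sub_nonneg]
  refine h.trans_eq ?_
  rw [apply_star_sum_mul_sum]
  simp only [Finset.mul_sum, ← Finset.sum_sub_distrib, Matrix.of_apply]
  exact Finset.sum_congr rfl fun i _ => Finset.sum_congr rfl fun j _ => by ring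

/-- The elements whose left multiplication is bounded for the seminorm of a positive
functional. -/
def leftBounded {A : Type*} [Ring A] [Algebra ℂ A] [StarRing A] [StarModule ℂ A]
    (ψ : A →ₗ[ℂ] ℂ) (hpos : ∀ a : A, 0 ≤ ψ (star a * a)) : Submodule ℂ A where
  carrier := {a | ∃ C : ℝ, 0 ≤ C ∧
    ∀ x : A, (ψ (star (a * x) * (a * x))).re ≤ C * (ψ (star x * x)).re}
  zero_mem' := ⟨0, le_rfl, fun x => by simp⟩
  add_mem' := by
    rintro a b ⟨C, hC, ha⟩ ⟨D, hD, hb⟩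
    refine ⟨2 * C + 2 * D, by positivity, fun x => ?_⟩
    have h := (Complex.nonneg_iff.1 (hpos (a * x - b * x))).1
    have ha := ha x
    have hb := hb x
    simp only [add_mul a b x, star_add, star_sub, add_mul, sub_mul, mul_add, mul_sub, map_add,
      map_sub, Complex.add_re, Complex.sub_re] at h ⊢
    linarith
  smul_mem' := by
    rintro c a ⟨C, hC, ha⟩
    refine ⟨Complex.normSq c * C, mul_nonneg (Complex.normSq_nonneg c) hC, fun x => ?_⟩
    have h : ψ (star (c • a * x) * (c • a * x)) =
        (Complex.normSq c : ℂ) * ψ (star (a * x) * (a * x)) := by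
      rw [smul_mul_assoc, star_smul, smul_mul_smul_comm, map_smul, smul_eq_mul,
        Complex.normSq_eq_conj_mul_self]
      rfl
    rw [h, Complex.re_ofReal_mul, mul_assoc]
    exact mul_le_mul_of_nonneg_left (ha x) (Complex.normSq_nonneg c)

/-- Invariance of a right integral, in terms of a decomposition of `Δ x` and paired against
`b`. -/
theorem IsRightIntegral.sum_mul_eq {A ι : Type*} [Fintype ι] [Ring A] [HopfAlgebra ℂ A]
    [StarRing A] [StarModule ℂ A]
    (hΔstar : ∀ a : A, Coalgebra.comul (R := ℂ) (star a) =
      tensorStar A (Coalgebra.comul (R := ℂ) a))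
    {ψ : A →ₗ[ℂ] ℂ} (hψ : IsRightIntegral A ψ) {x : A} {l r : ι → A}
    (hx : Coalgebra.comul (R := ℂ) x = ∑ i, l i ⊗ₜ[ℂ] r i) (b : A) :
    ∑ i, ∑ j, ψ (star (l i) * l j) * ψ (star (r i * b) * (r j * b)) =
      ψ (star x * x) * ψ (star b * b) := by
  have hstar (s t : A) : tensorStar A (s ⊗ₜ[ℂ] t) = star s ⊗ₜ[ℂ] star t := rfl
  have happ (s t : A) : lApply A ψ (s ⊗ₜ[ℂ] t) = ψ s • t := rfl
  have h := hψ (star x * x)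
  rw [Bialgebra.comul_mul, hΔstar, hx] at h
  simp only [map_sum, hstar, Finset.sum_mul_sum, Algebra.TensorProduct.tmul_mul_tmul, happ] at h
  have hb := congrArg (fun m => ψ (star b * m * b)) h
  simpa only [Finset.mul_sum, Finset.sum_mul, mul_smul_comm, smul_mul_assoc, map_sum, map_smul,
    smul_eq_mul, mul_one, star_mul, mul_assoc] using hb

/-- Left multiplication by `(ψ ⊗ id)((c ⊗ 1) Δ(x))` is bounded. -/
theorem IsRightIntegral.lApply_mem_leftBounded {A : Type*} [Ring A] [HopfAlgebra ℂ A]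
    [StarRing A] [StarModule ℂ A]
    (hΔstar : ∀ a : A, Coalgebra.comul (R := ℂ) (star a) =
      tensorStar A (Coalgebra.comul (R := ℂ) a))
    {ψ : A →ₗ[ℂ] ℂ} (hψ : IsRightIntegral A ψ) (hpos : ∀ a : A, 0 ≤ ψ (star a * a))
    (c x : A) :
    lApply A ψ ((c ⊗ₜ[ℂ] (1 : A)) * Coalgebra.comul (R := ℂ) x) ∈ leftBounded ψ hpos := by
  have happ (s t : A) : lApply A ψ (s ⊗ₜ[ℂ] t) = ψ s • t := rfl
  obtain ⟨s, hs⟩ := TensorProduct.exists_finset (R := ℂ) (Coalgebra.comul (R := ℂ) x)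
  rw [← Finset.sum_coe_sort] at hs
  have hc := Complex.nonneg_iff.1 (hpos (star c))
  have hx := Complex.nonneg_iff.1 (hpos x)
  refine ⟨(ψ (star (star c) * star c)).re * (ψ (star x * x)).re, mul_nonneg hc.1 hx.1,
    fun b => ?_⟩
  have h := apply_sum_slice_le hpos (star c) (fun i : s => i.1.1) (fun i : s => i.1.2 * b)
  rw [hψ.sum_mul_eq hΔstar hs b] at h
  have hm : lApply A ψ ((c ⊗ₜ[ℂ] (1 : A)) * Coalgebra.comul (R := ℂ) x) * b =
      ∑ i : s, ψ (star (star c) * i.1.1) • (i.1.2 * b) := by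
    rw [hs]
    simp only [Finset.mul_sum, Algebra.TensorProduct.tmul_mul_tmul, map_sum, happ, one_mul,
      Finset.sum_mul, smul_mul_assoc, star_star]
  rw [hm]
  refine (Complex.le_def.1 h).1.trans_eq ?_
  simp only [Complex.mul_re, Complex.mul_im, ← hc.2, ← hx.2]
  ring

theorem stmt9 (A : Type*) [Ring A] [HopfAlgebra ℂ A] [StarRing A] [StarModule ℂ A]
    (hΔstar : ∀ a : A, Coalgebra.comul (R := ℂ) (star a) =
      tensorStar A (Coalgebra.comul (R := ℂ) a))
    (ψ : A →ₗ[ℂ] ℂ) (hψ : IsRightIntegral A ψ)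
    (hpos : ∀ a : A, 0 ≤ ψ (star a * a))
    (hspan : Submodule.span ℂ
      {u : A ⊗[ℂ] A | ∃ x y : A, u = (x ⊗ₜ[ℂ] (1 : A)) * Coalgebra.comul (R := ℂ) y} = ⊤) :
    ∀ a : A, ∃ C : ℝ, 0 ≤ C ∧
      ∀ x : A, (ψ (star (a * x) * (a * x))).re ≤ C * (ψ (star x * x)).re := by
  intro a
  change a ∈ leftBounded ψ hpos
  have hle : (⊤ : Submodule ℂ (A ⊗[ℂ] A)) ≤ (leftBounded ψ hpos).comap (lApply A ψ) := by
    rw [← hspan, Submodule.span_le]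
    rintro _ ⟨x, y, rfl⟩
    exact hψ.lApply_mem_leftBounded hΔstar hpos x y
  by_cases h0 : ψ = 0
  · exact ⟨0, le_rfl, fun x => by simp [h0]⟩
  · obtain ⟨z, hz⟩ : ∃ z, ψ z ≠ 0 := by
      by_contra! h
      exact h0 (LinearMap.ext h)
    have h : ψ z • a ∈ leftBounded ψ hpos :=
      hle (Submodule.mem_top (x := z ⊗ₜ[ℂ] a))
    exact ((leftBounded ψ hpos).smul_mem_iff hz).1 h
end

section
/- Let ψ : A → ℂ be a right integral, and let T : A ⊗[ℂ] A → A ⊗[ℂ] A be the linear map determined by T(x ⊗ y) = Δ(x) * (1 ⊗ y). Then for every u ∈ A ⊗[ℂ] A, (ψ ⊗ ψ)(star (T u) * (T u)) = (ψ ⊗ ψ)(star u * u), where ψ ⊗ ψ denotes the linear functional on A ⊗[ℂ] A induced by ψ in each tensor factor and star acts factorwise on A ⊗ A. -/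
open scoped TensorProduct
open TensorProduct
open scoped ComplexOrder

/-- The canonical map `x ⊗ y ↦ Δ(x)(1 ⊗ y)` on `A ⊗[ℂ] A`. -/
noncomputable def canonicalMapT (A : Type*) [Ring A] [Bialgebra ℂ A] :
    A ⊗[ℂ] A →ₗ[ℂ] A ⊗[ℂ] A :=
  TensorProduct.lift
    (LinearMap.mk₂ ℂ (fun x y => Coalgebra.comul (R := ℂ) x * ((1 : A) ⊗ₜ[ℂ] y))
      (fun x x' y => by simp [map_add, add_mul])
      (fun c x y => by simp [map_smul, smul_mul_assoc])
      (fun x y y' => by simp [TensorProduct.tmul_add, mul_add])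
      (fun c x y => by simp [TensorProduct.tmul_smul, mul_smul_comm]))

/-- `ψ ⊗ ψ` as a linear functional on `A ⊗[ℂ] A`. -/
noncomputable def tensorFunctional (A : Type*) [Ring A] [Algebra ℂ A]
    (ψ χ : A →ₗ[ℂ] ℂ) : A ⊗[ℂ] A →ₗ[ℂ] ℂ :=
  (TensorProduct.lid ℂ ℂ).toLinearMap ∘ₗ TensorProduct.map ψ χ

theorem tensorStar_tmul (A : Type*) [Ring A] [Algebra ℂ A] [StarRing A] [StarModule ℂ A]
    (x y : A) : tensorStar A (x ⊗ₜ[ℂ] y) = star x ⊗ₜ[ℂ] star y :=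
  rfl

theorem tensorStar_mul (A : Type*) [Ring A] [Algebra ℂ A] [StarRing A] [StarModule ℂ A]
    (u v : A ⊗[ℂ] A) : tensorStar A (u * v) = tensorStar A v * tensorStar A u := by
  induction u using TensorProduct.induction_on with
  | zero => simp
  | add u₁ u₂ h₁ h₂ => simp only [add_mul, map_add, mul_add, h₁, h₂]
  | tmul a b =>
    induction v using TensorProduct.induction_on with
    | zero => simp
    | add v₁ v₂ h₁ h₂ => simp only [add_mul, map_add, mul_add, h₁, h₂]
    | tmul c d =>
      simp only [Algebra.TensorProduct.tmul_mul_tmul, tensorStar_tmul, star_mul]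

theorem canonicalMapT_tmul (A : Type*) [Ring A] [Bialgebra ℂ A] (x y : A) :
    canonicalMapT A (x ⊗ₜ[ℂ] y) = Coalgebra.comul (R := ℂ) x * ((1 : A) ⊗ₜ[ℂ] y) :=
  rfl

theorem lApply_tmul (A : Type*) [Ring A] [Algebra ℂ A] (φ : A →ₗ[ℂ] ℂ) (x y : A) :
    lApply A φ (x ⊗ₜ[ℂ] y) = φ x • y := by
  simp [lApply]

/-- `φ ⊗ id` is a bimodule map over the second tensor factor. -/
theorem lApply_one_tmul_mul_mul (A : Type*) [Ring A] [Algebra ℂ A] (φ : A →ₗ[ℂ] ℂ)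
    (a b : A) (w : A ⊗[ℂ] A) :
    lApply A φ (((1 : A) ⊗ₜ[ℂ] a) * w * ((1 : A) ⊗ₜ[ℂ] b)) = a * lApply A φ w * b := by
  induction w using TensorProduct.induction_on with
  | zero => simp
  | add w₁ w₂ h₁ h₂ => simp only [add_mul, map_add, mul_add, h₁, h₂]
  | tmul x y => simp [lApply_tmul]

theorem tensorFunctional_eq_comp_lApply (A : Type*) [Ring A] [Algebra ℂ A]
    (ψ χ : A →ₗ[ℂ] ℂ) (w : A ⊗[ℂ] A) :
    tensorFunctional A ψ χ w = χ (lApply A ψ w) := by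
  induction w using TensorProduct.induction_on with
  | zero => simp
  | add w₁ w₂ h₁ h₂ => simp only [map_add, h₁, h₂]
  | tmul x y => simp [lApply_tmul, tensorFunctional]

/-- The map `T` preserves the sesquilinear form attached to `ψ ⊗ χ` when `ψ` is a right integral. -/
theorem tensorFunctional_tensorStar_canonicalMapT_mul (A : Type*) [Ring A] [Bialgebra ℂ A]
    [StarRing A] [StarModule ℂ A]
    (hΔstar : ∀ a : A, Coalgebra.comul (R := ℂ) (star a) =
      tensorStar A (Coalgebra.comul (R := ℂ) a))
    (ψ χ : A →ₗ[ℂ] ℂ) (hψ : IsRightIntegral A ψ) (u v : A ⊗[ℂ] A) :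
    tensorFunctional A ψ χ (tensorStar A (canonicalMapT A u) * canonicalMapT A v) =
      tensorFunctional A ψ χ (tensorStar A u * v) := by
  induction u using TensorProduct.induction_on with
  | zero => simp
  | add u₁ u₂ h₁ h₂ => simp only [map_add, add_mul, h₁, h₂]
  | tmul x y =>
    induction v using TensorProduct.induction_on with
    | zero => simp
    | add v₁ v₂ h₁ h₂ => simp only [map_add, mul_add, h₁, h₂]
    | tmul x' y' =>
      have key : tensorStar A (canonicalMapT A (x ⊗ₜ[ℂ] y)) * canonicalMapT A (x' ⊗ₜ[ℂ] y') =
          ((1 : A) ⊗ₜ[ℂ] star y) * Coalgebra.comul (R := ℂ) (star x * x') *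
            ((1 : A) ⊗ₜ[ℂ] y') := by
        rw [canonicalMapT_tmul, canonicalMapT_tmul, tensorStar_mul, tensorStar_tmul, star_one,
          ← hΔstar, Bialgebra.comul_mul]
        simp only [mul_assoc]
      rw [key, tensorFunctional_eq_comp_lApply, tensorFunctional_eq_comp_lApply,
        lApply_one_tmul_mul_mul, hψ, tensorStar_tmul, Algebra.TensorProduct.tmul_mul_tmul,
        lApply_tmul]
      simp

theorem stmt11 (A : Type*) [Ring A] [HopfAlgebra ℂ A] [StarRing A] [StarModule ℂ A]
    (hΔstar : ∀ a : A, Coalgebra.comul (R := ℂ) (star a) =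
      tensorStar A (Coalgebra.comul (R := ℂ) a))
    (ψ : A →ₗ[ℂ] ℂ) (hψ : IsRightIntegral A ψ) :
    ∀ u : A ⊗[ℂ] A,
      tensorFunctional A ψ ψ (tensorStar A (canonicalMapT A u) * canonicalMapT A u) =
      tensorFunctional A ψ ψ (tensorStar A u * u) := by
  exact fun u => tensorFunctional_tensorStar_canonicalMapT_mul A hΔstar ψ ψ hψ u u
end

section
/- Suppose η ∈ H is right bounded with operator R, and suppose η' ∈ H satisfies ⟪Λ(star a), η⟫ = ⟪η', Λ a⟫ for all a ∈ A. Then η' is right bounded with operator R† (the Hilbert-space adjoint of R); that is, π(a) η' = R†(Λ a) for all a ∈ A. -/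
open scoped InnerProductSpace ComplexOrder
open Filter Topology

theorem stmt14
    (H : Type*) [NormedAddCommGroup H] [InnerProductSpace ℂ H] [CompleteSpace H]
    (A : Type*) [Ring A] [Algebra ℂ A] [StarRing A] [StarModule ℂ A]
    (Lam : A →ₗ[ℂ] H) (hinj : Function.Injective Lam) (hdense : DenseRange Lam)
    (pi : A → H →L[ℂ] H) (hpi : ∀ a b : A, pi a (Lam b) = Lam (a * b))
    (hadj : ∀ a b c : A, ⟪Lam (a * b), Lam c⟫_ℂ = ⟪Lam b, Lam (star a * c)⟫_ℂ)
    (hdense2 : Dense (↑(Submodule.span ℂ {v : H | ∃ a b : A, v = Lam (a * b)}) : Set H))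
    (eta : H) (R : H →L[ℂ] H) (hR : ∀ a : A, R (Lam a) = pi a eta)
    (eta' : H) (heta' : ∀ a : A, ⟪Lam (star a), eta⟫_ℂ = ⟪eta', Lam a⟫_ℂ) :
    ∀ a : A, pi a eta' = (ContinuousLinearMap.adjoint R) (Lam a) := by
  have pi_inner : ∀ (a : A) (x y : H), ⟪pi a x, y⟫_ℂ = ⟪x, pi (star a) y⟫_ℂ := by
    intro a x y
    refine hdense.induction_on₂ (p := fun x y => ⟪pi a x, y⟫_ℂ = ⟪x, pi (star a) y⟫_ℂ)
      (isClosed_eq (by fun_prop) (by fun_prop)) (fun b c => ?_) x y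
    rw [hpi, hpi, hadj]
  intro a
  refine hdense.eq_of_inner_left (𝕜 := ℂ) fun b => ?_
  calc ⟪pi a eta', Lam b⟫_ℂ = ⟪eta', Lam (star a * b)⟫_ℂ := by rw [pi_inner, hpi]
    _ = ⟪pi (star b) (Lam a), eta⟫_ℂ := by rw [← heta', star_mul, star_star, hpi]
    _ = ⟪Lam a, R (Lam b)⟫_ℂ := by rw [pi_inner, star_star, hR]
    _ = ⟪(ContinuousLinearMap.adjoint R) (Lam a), Lam b⟫_ℂ := by
      rw [ContinuousLinearMap.adjoint_inner_left]
end

section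
/- For a positive operator x in M define ψ(x) ∈ [0, ∞] as the supremum of the extended nonnegative reals ENNReal.ofReal(re ⟪x η, η⟫) over all right bounded vectors η whose operator R satisfies ‖R‖ ≤ 1. Then ψ is additive on positive elements of M: for all positive x, y ∈ M, ψ(x + y) = ψ(x) + ψ(y). -/
open scoped InnerProductSpace ComplexOrder
open Filter Topology

/-- The weight associated with the left Hilbert algebra data `(Lam, pi)`:
`ψ(x) = ⨆ {⟪x η, η⟫.re : η right bounded with operator of norm at most 1}`. -/
noncomputable def hilbertWeight {H A : Type*} [NormedAddCommGroup H] [InnerProductSpace ℂ H]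
    [Ring A] [Algebra ℂ A] (Lam : A →ₗ[ℂ] H) (pi : A → H →L[ℂ] H)
    (x : H →L[ℂ] H) : ENNReal :=
  ⨆ (eta : H) (R : H →L[ℂ] H) (_ : ∀ a : A, R (Lam a) = pi a eta) (_ : ‖R‖ ≤ 1),
    ENNReal.ofReal (⟪x eta, eta⟫_ℂ).re

section CStar
variable {B : Type*} [CStarAlgebra B] [PartialOrder B] [StarOrderedRing B]

/-- For a strict contraction `r`, the inverse of `1 - star r * r` exceeds `1` by at most a multiple
of `star r * r`. -/
theorem exists_inverse_one_sub_star_mul_self (r : B) (hr : ‖r‖ < 1) :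
    ∃ u : Bˣ, (↑u⁻¹ : B) = 1 - star r * r ∧ (1 : B) ≤ u ∧
      ∃ k : ℝ, 0 ≤ k ∧ (u : B) - 1 ≤ k • (star r * r) := by
  have hn : ‖star r * r‖ < 1 := by
    rw [CStarRing.norm_star_mul_self]; nlinarith [norm_nonneg r]
  have h0 : 0 ≤ star r * r := star_mul_self_nonneg r
  have h1 : star r * r ≤ 1 := (CStarAlgebra.norm_le_one_iff_of_nonneg _ h0).1 hn.le
  set w := Units.oneSub (star r * r) hn
  have hwv : (w : B) = 1 - star r * r := rfl
  have hu : (1 : B) ≤ ↑w⁻¹ := by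
    rw [CStarAlgebra.one_le_inv_iff_le_one (by rw [hwv]; exact sub_nonneg.2 h1),
      ← Units.val_le_val, hwv]
    exact sub_le_self _ h0
  refine ⟨w⁻¹, by simp [hwv], hu, ‖1 + r * ↑w⁻¹ * star r‖, norm_nonneg _, ?_⟩
  have hsa : IsSelfAdjoint (1 + r * ↑w⁻¹ * star r : B) :=
    (IsSelfAdjoint.one B).add ((zero_le_one.trans hu).isSelfAdjoint.conjugate r)
  refine le_of_eq_of_le ?_ (CStarAlgebra.star_left_conjugate_le_norm_smul (a := r) hsa)
  have e1 : (↑w⁻¹ : B) = 1 + star r * r * ↑w⁻¹ := by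
    have := w.mul_inv
    rw [hwv, sub_mul, one_mul, sub_eq_iff_eq_add] at this
    exact this
  have e2 : (↑w⁻¹ : B) = 1 + ↑w⁻¹ * (star r * r) := by
    have := w.inv_mul
    rw [hwv, mul_sub, mul_one, sub_eq_iff_eq_add] at this
    exact this
  have e3 : (↑w⁻¹ : B) - 1 = star r * r + star r * r * (↑w⁻¹ * (star r * r)) := by
    conv_lhs => rw [e1, e2]
    noncomm_ring
  rw [e3]; noncomm_ring

/-- The elements `star r * r` of norm less than one are upward directed, with an upper bound that
is dominated by a multiple of their sum. -/
theorem exists_dominating (r s : B) (hr : ‖r‖ < 1) (hs : ‖s‖ < 1) :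
    ∃ c : B, star r * r ≤ c ∧ star s * s ≤ c ∧ c ≤ 1 ∧
      (∃ k : ℝ, 0 ≤ k ∧ c ≤ k • (star r * r + star s * s)) ∧
      ∀ z, Commute z (star r * r) → Commute z (star s * s) → Commute z c := by
  obtain ⟨u, hu, hu1, k, hk, huk⟩ := exists_inverse_one_sub_star_mul_self r hr
  obtain ⟨v, hv, hv1, l, hl, hvl⟩ := exists_inverse_one_sub_star_mul_self s hs
  have hmu : (u : B) ≤ u + v - 1 := by
    rw [add_sub_assoc]; exact le_add_of_nonneg_right (sub_nonneg.2 hv1)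
  have hmv : (v : B) ≤ u + v - 1 := by
    rw [add_comm, add_sub_assoc]; exact le_add_of_nonneg_right (sub_nonneg.2 hu1)
  obtain ⟨m, hm⟩ := CStarAlgebra.isUnit_of_le (u : B) hmu
    (IsStrictlyPositive.iff_of_unital.2 ⟨zero_le_one.trans hu1, u.isUnit⟩)
  rw [← hm] at hmu hmv
  have hm0 : (0 : B) ≤ m := (zero_le_one.trans hu1).trans hmu
  have hmi := CStarAlgebra.inv_le_inv (zero_le_one.trans hu1) hmu
  have hmi' := CStarAlgebra.inv_le_inv (zero_le_one.trans hv1) hmv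
  rw [hu] at hmi
  rw [hv] at hmi'
  have hinv0 : (0 : B) ≤ ↑m⁻¹ := CFC.inv_nonneg_of_nonneg m hm0
  refine ⟨1 - ↑m⁻¹, le_sub_comm.1 hmi, le_sub_comm.1 hmi', sub_le_self _ hinv0,
    ⟨max k l, le_max_of_le_left hk, ?_⟩, ?_⟩
  · have h1 : (1 : B) - ↑m⁻¹ ≤ m - 1 := by
      rw [← sub_nonneg]
      have := star_left_conjugate_nonneg hinv0 (m - 1 : B)
      rw [star_sub, star_one, hm0.isSelfAdjoint.star_eq] at this
      convert this using 1
      simp [mul_sub, sub_mul]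
    refine h1.trans ?_
    have : (m : B) - 1 = (u - 1) + (v - 1) := by rw [hm]; abel
    rw [this, smul_add]
    refine add_le_add (huk.trans ?_) (hvl.trans ?_)
    · exact smul_le_smul_of_nonneg_right (le_max_left _ _) (star_mul_self_nonneg r)
    · exact smul_le_smul_of_nonneg_right (le_max_right _ _) (star_mul_self_nonneg s)
  · intro z hz hz'
    have h1 : Commute z (u : B) := by
      have : Commute z (↑u⁻¹ : B) := hu ▸ (Commute.one_right z).sub_right hz
      simpa using this.units_inv_right
    have h2 : Commute z (v : B) := by
      have : Commute z (↑v⁻¹ : B) := hv ▸ (Commute.one_right z).sub_right hz'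
      simpa using this.units_inv_right
    have h3 : Commute z (m : B) := hm ▸ (h1.add_right h2).sub_right (Commute.one_right z)
    exact (Commute.one_right z).sub_right h3.units_inv_right

end CStar

section Douglas
variable {E F G : Type*} [NormedAddCommGroup E] [InnerProductSpace ℂ E]
  [NormedAddCommGroup F] [InnerProductSpace ℂ F] [CompleteSpace F]
  [NormedAddCommGroup G] [InnerProductSpace ℂ G] [CompleteSpace G]

/-- Douglas factorization: if `‖T v‖ ≤ ‖S v‖` for all `v`, then `T` factors through `S` by a
contraction vanishing on the orthogonal complement of the range of `S`. -/
theorem exists_factor_of_norm_le (S : E →L[ℂ] F) (T : E →L[ℂ] G) (h : ∀ v, ‖T v‖ ≤ ‖S v‖) :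
    ∃ V : F →L[ℂ] G, ‖V‖ ≤ 1 ∧ (∀ v, V (S v) = T v) ∧
      ∀ k : F, (∀ v, ⟪S v, k⟫_ℂ = 0) → V k = 0 := by
  let K : Submodule ℂ F := (LinearMap.range S.toLinearMap).topologicalClosure
  have hK : ∀ v, S v ∈ K := fun v => Submodule.le_topologicalClosure _ ⟨v, rfl⟩
  have : CompleteSpace K := (Submodule.isClosed_topologicalClosure _).completeSpace_coe
  let e : E →ₗ[ℂ] K := S.toLinearMap.codRestrict K hK
  have he : DenseRange e := by
    intro x
    rw [Metric.mem_closure_iff]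
    intro ε hε
    obtain ⟨_, ⟨v, rfl⟩, hv⟩ := Metric.mem_closure_iff.1 x.2 ε hε
    exact ⟨e v, ⟨v, rfl⟩, hv⟩
  have hn : ∀ v, ‖T.toLinearMap v‖ ≤ 1 * ‖e v‖ := fun v => by rw [one_mul]; exact h v
  let W := T.toLinearMap.extendOfNorm e
  refine ⟨W ∘L K.orthogonalProjectionOnto, ?_, ?_, ?_⟩
  · refine (ContinuousLinearMap.opNorm_comp_le _ _).trans ?_
    exact mul_le_one₀ (LinearMap.opNorm_extendOfNorm_le he zero_le_one hn) (norm_nonneg _)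
      (Submodule.orthogonalProjectionOnto_norm_le K)
  · intro v
    have : K.orthogonalProjectionOnto (S v) = e v :=
      Submodule.orthogonalProjectionOnto_mem_subspace_eq_self (e v)
    rw [ContinuousLinearMap.comp_apply, this]
    exact LinearMap.extendOfNorm_eq he ⟨1, hn⟩ v
  · intro k hk
    have hmem : k ∈ Kᗮ := by
      rw [Submodule.orthogonal_closure]
      rintro _ ⟨v, rfl⟩
      exact hk v
    rw [ContinuousLinearMap.comp_apply,
      Submodule.orthogonalProjectionOnto_eq_zero_iff.2 hmem, map_zero]

/-- The factor can be chosen to intertwine everything that `S` and `T` intertwine. -/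
theorem exists_intertwining_factor {ι : Type*} (p : ι → E →L[ℂ] E) (q : ι → F →L[ℂ] F)
    (t : ι → G →L[ℂ] G) (S : E →L[ℂ] F) (T : E →L[ℂ] G) (h : ∀ v, ‖T v‖ ≤ ‖S v‖)
    (hS : ∀ i v, S (p i v) = q i (S v)) (hT : ∀ i v, T (p i v) = t i (T v))
    (hq : ∀ i, ∃ j, ∀ v w, ⟪q j v, w⟫_ℂ = ⟪v, q i w⟫_ℂ) :
    ∃ V : F →L[ℂ] G, ‖V‖ ≤ 1 ∧ (∀ v, V (S v) = T v) ∧ ∀ i w, V (q i w) = t i (V w) := by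
  obtain ⟨V, hV, hVS, hV0⟩ := exists_factor_of_norm_le S T h
  refine ⟨V, hV, hVS, fun i w => ?_⟩
  let K : Submodule ℂ F := (LinearMap.range S.toLinearMap).topologicalClosure
  have : CompleteSpace K := (Submodule.isClosed_topologicalClosure _).completeSpace_coe
  have hperp : ∀ k ∈ Kᗮ, ∀ v, ⟪S v, k⟫_ℂ = 0 := fun k hk v =>
    hk _ (Submodule.le_topologicalClosure _ ⟨v, rfl⟩)
  have h1 : ∀ k ∈ K, V (q i k) = t i (V k) := by
    intro k hk
    have hcl : IsClosed {k : F | V (q i k) = t i (V k)} :=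
      isClosed_eq (by fun_prop) (by fun_prop)
    refine closure_minimal ?_ hcl hk
    rintro _ ⟨v, rfl⟩
    change V (q i (S v)) = t i (V (S v))
    rw [← hS, hVS, hVS, hT]
  obtain ⟨y, hy, z, hz, rfl⟩ := K.exists_add_mem_mem_orthogonal w
  obtain ⟨j, hj⟩ := hq i
  have h2 : V (q i z) = 0 := hV0 _ fun v => by
    rw [← hj, ← hS]; exact hperp z hz _
  simp [h1 y hy, h2, hV0 z (hperp z hz)]

end Douglas

section Hilbert
variable {H : Type*} [NormedAddCommGroup H] [InnerProductSpace ℂ H]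

theorem re_inner_mono {c d : H →L[ℂ] H} (h : c ≤ d) (v : H) :
    (⟪c v, v⟫_ℂ).re ≤ (⟪d v, v⟫_ℂ).re := by
  have := ((ContinuousLinearMap.le_def _ _).1 h).re_inner_nonneg_left v
  simpa [inner_sub_left] using this

variable [CompleteSpace H]

theorem re_inner_star_mul_self (R : H →L[ℂ] H) (v : H) :
    (⟪(star R * R) v, v⟫_ℂ).re = ‖R v‖ ^ 2 := by
  rw [mul_apply_eq_comp, ContinuousLinearMap.star_eq_adjoint,
    ContinuousLinearMap.adjoint_inner_left]
  exact (norm_sq_eq_re_inner (𝕜 := ℂ) _).symm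

theorem norm_sqrt_apply_sq {c : H →L[ℂ] H} (hc : 0 ≤ c) (v : H) :
    ‖CFC.sqrt c v‖ ^ 2 = (⟪c v, v⟫_ℂ).re := by
  rw [← re_inner_star_mul_self, (CFC.sqrt_nonneg c).isSelfAdjoint.star_eq,
    CFC.sqrt_mul_sqrt_self c hc]

/-- Compressing by a commuting contraction decreases a positive form. -/
theorem re_inner_contraction_le {x T : H →L[ℂ] H} (hx : 0 ≤ x) (hxT : Commute x T)
    (hT : ‖T‖ ≤ 1) (v : H) : (⟪x (T v), T v⟫_ℂ).re ≤ (⟪x v, v⟫_ℂ).re := by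
  rw [← norm_sqrt_apply_sq hx, ← norm_sqrt_apply_sq hx]
  have hc : Commute (CFC.sqrt x) T := hxT.cfcₙ_nnreal _
  have : CFC.sqrt x (T v) = T (CFC.sqrt x v) := DFunLike.congr_fun hc.eq v
  rw [this]
  gcongr
  exact T.le_of_opNorm_le hT _ |>.trans_eq (one_mul _)

/-- Two vectors whose operators have norm less than one are images, under contractions in the
commutant of `pi`, of one right bounded vector whose operator is a contraction. -/
theorem exists_common_dilation {A : Type*} [Star A] (L : A → H) (pi : A → H →L[ℂ] H)
    (hstar : ∀ a, pi (star a) = star (pi a)) (hnd : ∀ v, (∀ a, pi a v = 0) → v = 0)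
    {e f : H} {R S : H →L[ℂ] H} (hR : ∀ a, R (L a) = pi a e) (hS : ∀ a, S (L a) = pi a f)
    (hRc : ∀ a, Commute R (pi a)) (hSc : ∀ a, Commute S (pi a)) (hRn : ‖R‖ < 1) (hSn : ‖S‖ < 1) :
    ∃ (z : H) (Q T U : H →L[ℂ] H), (∀ a, Q (L a) = pi a z) ∧ ‖Q‖ ≤ 1 ∧
      (∀ a, Commute T (pi a)) ∧ ‖T‖ ≤ 1 ∧ T z = e ∧
      (∀ a, Commute U (pi a)) ∧ ‖U‖ ≤ 1 ∧ U z = f := by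
  obtain ⟨c, hRle, hSle, hc1, ⟨k, hk, hck⟩, hcomm⟩ := exists_dominating R S hRn hSn
  have hc0 : 0 ≤ c := (star_mul_self_nonneg R).trans hRle
  have star_mul_comm : ∀ {X : H →L[ℂ] H}, (∀ a, Commute X (pi a)) →
      ∀ a, Commute (pi a) (star X * X) := fun hX a => by
    have := (hX (star a)).star_star
    rw [hstar, star_star] at this
    exact this.symm.mul_right (hX a).symm
  set q := CFC.sqrt c
  have hqc : ∀ a, Commute q (pi a) := fun a =>
    (hcomm _ (star_mul_comm hRc a) (star_mul_comm hSc a)).symm.cfcₙ_nnreal _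
  have app : ∀ {X Y : H →L[ℂ] H}, Commute X Y → ∀ v, X (Y v) = Y (X v) :=
    fun h v => DFunLike.congr_fun h.eq v
  have hadj : ∀ a, ∀ v w, ⟪pi (star a) v, w⟫_ℂ = ⟪v, pi a w⟫_ℂ := fun a v w => by
    rw [hstar, ContinuousLinearMap.star_eq_adjoint, ContinuousLinearMap.adjoint_inner_left]
  have hqn : ‖q‖ ≤ 1 := q.opNorm_le_bound zero_le_one fun v => by
    rw [one_mul]
    refine le_of_sq_le_sq ?_ (norm_nonneg _)
    rw [norm_sqrt_apply_sq hc0]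
    refine (re_inner_mono hc1 v).trans_eq ?_
    exact (norm_sq_eq_re_inner (𝕜 := ℂ) v).symm
  let ε := (WithLp.prodContinuousLinearEquiv 2 ℂ H H)
  let D : A → WithLp 2 (H × H) →L[ℂ] WithLp 2 (H × H) := fun a =>
    ε.symm.toContinuousLinearMap ∘L ((pi a).prodMap (pi a)) ∘L ε.toContinuousLinearMap
  let C : H →L[ℂ] WithLp 2 (H × H) :=
    (Real.sqrt k : ℂ) • (ε.symm.toContinuousLinearMap ∘L (R.prod S))
  have hC : ∀ v, C v = (Real.sqrt k : ℂ) • WithLp.toLp 2 (R v, S v) := fun v => rfl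
  have hD : ∀ a v w, D a (WithLp.toLp 2 (v, w)) = WithLp.toLp 2 (pi a v, pi a w) :=
    fun a v w => rfl
  have hle : ∀ v, ‖q v‖ ≤ ‖C v‖ := fun v => by
    refine le_of_sq_le_sq ?_ (norm_nonneg _)
    rw [norm_sqrt_apply_sq hc0, hC, norm_smul, mul_pow, WithLp.prod_norm_sq_eq_of_L2]
    refine (re_inner_mono hck v).trans_eq ?_
    have h1 := re_inner_star_mul_self R v
    have h2 := re_inner_star_mul_self S v
    simp only [smul_apply, add_apply, inner_add_left,
      inner_smul_left_eq_smul, Complex.add_re, Complex.smul_re, h1, h2]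
    simp [Real.sq_sqrt hk]
  obtain ⟨V, -, hVC, hVD⟩ := exists_intertwining_factor pi D pi C q hle
    (fun a v => by rw [hC, hC, map_smul, hD, app (hRc a), app (hSc a)])
    (fun a v => app (hqc a) v)
    (fun a => ⟨star a, fun v w => by
      obtain ⟨v₁, v₂⟩ := v
      obtain ⟨w₁, w₂⟩ := w
      rw [hD, hD]
      simp [hadj]⟩)
  let z := V ((Real.sqrt k : ℂ) • WithLp.toLp 2 (e, f))
  have hz : ∀ a, q (L a) = pi a z := fun a => by
    rw [← hVC, hC, hR, hS, ← hD, ← map_smul, hVD]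
  have factor : ∀ {X : H →L[ℂ] H} {g : H}, (∀ a, X (L a) = pi a g) →
      (∀ a, Commute X (pi a)) → star X * X ≤ c →
      ∃ T : H →L[ℂ] H, (∀ a, Commute T (pi a)) ∧ ‖T‖ ≤ 1 ∧ T z = g := by
    intro X g hX hXc hXle
    obtain ⟨T, hT, hTq, hTc⟩ := exists_intertwining_factor pi pi pi q X
      (fun v => by
        refine le_of_sq_le_sq ?_ (norm_nonneg _)
        rw [norm_sqrt_apply_sq hc0, ← re_inner_star_mul_self]
        exact re_inner_mono hXle v)
      (fun a => app (hqc a)) (fun a => app (hXc a)) (fun a => ⟨star a, hadj a⟩)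
    refine ⟨T, fun a => ContinuousLinearMap.ext (hTc a), hT, sub_eq_zero.1 (hnd _ fun a => ?_)⟩
    rw [map_sub, ← hTc, ← hz, hTq, hX, sub_self]
  obtain ⟨T, hTc, hT, hTz⟩ := factor hR hRc hRle
  obtain ⟨U, hUc, hU, hUz⟩ := factor hS hSc hSle
  exact ⟨z, q, T, U, hz, hqn, hTc, hT, hTz, hUc, hU, hUz⟩

end Hilbert

section Weight
variable {H A : Type*} [NormedAddCommGroup H] [InnerProductSpace ℂ H] [Ring A] [Algebra ℂ A]
  {Lam : A →ₗ[ℂ] H} {pi : A → H →L[ℂ] H}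

theorem le_hilbertWeight {x : H →L[ℂ] H} {e : H} {R : H →L[ℂ] H}
    (hR : ∀ a, R (Lam a) = pi a e) (hn : ‖R‖ ≤ 1) :
    ENNReal.ofReal (⟪x e, e⟫_ℂ).re ≤ hilbertWeight Lam pi x :=
  le_iSup₂_of_le e R (le_iSup₂_of_le hR hn le_rfl)

theorem hilbertWeight_eq_iSup (x : H →L[ℂ] H) :
    hilbertWeight Lam pi x =
      ⨆ (p : H × (H →L[ℂ] H)) (_ : (∀ a : A, p.2 (Lam a) = pi a p.1) ∧ ‖p.2‖ ≤ 1),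
        ENNReal.ofReal (⟪x p.1, p.1⟫_ℂ).re := by
  simp only [hilbertWeight, iSup_prod, iSup_and]

end Weight

theorem stmt17
    (H : Type*) [NormedAddCommGroup H] [InnerProductSpace ℂ H] [CompleteSpace H]
    (A : Type*) [Ring A] [Algebra ℂ A] [StarRing A] [StarModule ℂ A]
    (Lam : A →ₗ[ℂ] H) (hinj : Function.Injective Lam) (hdense : DenseRange Lam)
    (pi : A → H →L[ℂ] H) (hpi : ∀ a b : A, pi a (Lam b) = Lam (a * b))
    (hadj : ∀ a b c : A, ⟪Lam (a * b), Lam c⟫_ℂ = ⟪Lam b, Lam (star a * c)⟫_ℂ)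
    (hdense2 : Dense (↑(Submodule.span ℂ {v : H | ∃ a b : A, v = Lam (a * b)}) : Set H))
    (x y : H →L[ℂ] H)
    (hxM : ∀ z : H →L[ℂ] H, (∀ a : A, Commute z (pi a)) → Commute x z)
    (hyM : ∀ z : H →L[ℂ] H, (∀ a : A, Commute z (pi a)) → Commute y z)
    (hxpos : ∀ xi : H, 0 ≤ ⟪x xi, xi⟫_ℂ)
    (hypos : ∀ xi : H, 0 ≤ ⟪y xi, xi⟫_ℂ) :
    hilbertWeight Lam pi (x + y) = hilbertWeight Lam pi x + hilbertWeight Lam pi y := by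

  have pos : ∀ w : H →L[ℂ] H, (∀ v, 0 ≤ ⟪w v, v⟫_ℂ) → 0 ≤ w := fun w hw => by
    rw [ContinuousLinearMap.nonneg_iff_isPositive, ContinuousLinearMap.isPositive_iff_complex]
    intro v
    obtain ⟨h1, h2⟩ := Complex.nonneg_iff.1 (hw v)
    exact ⟨Complex.ext rfl h2, h1⟩
  have hx0 : 0 ≤ x := pos x hxpos
  have hy0 : 0 ≤ y := pos y hypos
  have hmul : ∀ a b, pi (a * b) = pi a * pi b := fun a b =>
    DFunLike.coe_injective <| hdense.equalizer (by fun_prop) (by fun_prop) <| by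
      ext c
      simp [hpi, mul_assoc]
  have hstar : ∀ a, pi (star a) = star (pi a) := fun a => by
    refine DFunLike.coe_injective <| hdense.equalizer (by fun_prop) (by fun_prop) <| ?_
    ext c
    refine hdense.eq_of_inner_right ℂ fun b => ?_
    simp only [Function.comp_apply]
    rw [ContinuousLinearMap.star_eq_adjoint, ContinuousLinearMap.adjoint_inner_right, hpi, hpi,
      hadj]
  have hnd : ∀ v, (∀ a, pi a v = 0) → v = 0 := fun v hv => by
    have hker : Submodule.span ℂ {v : H | ∃ a b : A, v = Lam (a * b)} ≤ (ℂ ∙ v)ᗮ := by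
      rw [Submodule.span_le]
      rintro _ ⟨a, b, rfl⟩
      rw [SetLike.mem_coe, Submodule.mem_orthogonal_singleton_iff_inner_left, ← hpi,
        ← star_star a, hstar, ContinuousLinearMap.star_eq_adjoint,
        ContinuousLinearMap.adjoint_inner_left, hv, inner_zero_right]
    exact hdense2.eq_zero_of_inner_right ℂ fun w hw =>
      Submodule.mem_orthogonal_singleton_iff_inner_left.1 (hker hw)
  have hcomm : ∀ {e : H} {R : H →L[ℂ] H}, (∀ a, R (Lam a) = pi a e) →
      ∀ a, Commute R (pi a) := fun {e R} hR a =>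
    DFunLike.coe_injective <| hdense.equalizer (by fun_prop) (by fun_prop) <| by
      ext c
      simp [hpi, hR, hmul]
  apply le_antisymm
  · refine iSup₂_le fun e R => iSup₂_le fun hR hn => ?_
    rw [add_apply, inner_add_left, Complex.add_re]
    exact ENNReal.ofReal_add_le.trans (add_le_add (le_hilbertWeight hR hn) (le_hilbertWeight hR hn))
  rw [hilbertWeight_eq_iSup x, hilbertWeight_eq_iSup y]
  refine ENNReal.biSup_add_biSup_le' ⟨0, by simp⟩ ⟨0, by simp⟩ ?_
  rintro ⟨e, R⟩ ⟨hR, hRn⟩ ⟨f, S⟩ ⟨hS, hSn⟩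
  dsimp only at hR hRn hS hSn ⊢
  have hex : 0 ≤ (⟪x e, e⟫_ℂ).re := (Complex.nonneg_iff.1 (hxpos e)).1
  have hfy : 0 ≤ (⟪y f, f⟫_ℂ).re := (Complex.nonneg_iff.1 (hypos f)).1
  rw [← ENNReal.ofReal_add hex hfy]
  have scaled : ∀ t : ℝ, t ∈ Set.Ioo (0 : ℝ) 1 →
      ENNReal.ofReal (t ^ 2 * ((⟪x e, e⟫_ℂ).re + (⟪y f, f⟫_ℂ).re)) ≤
        hilbertWeight Lam pi (x + y) := by
    rintro t ⟨ht0, ht1⟩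
    have hlt : ∀ {X : H →L[ℂ] H}, ‖X‖ ≤ 1 → ‖(t : ℂ) • X‖ < 1 := fun {X} hX => by
      rw [norm_smul, Complex.norm_real, Real.norm_of_nonneg ht0.le]
      nlinarith [norm_nonneg X]
    have hb : ∀ {g : H} {X : H →L[ℂ] H}, (∀ a, X (Lam a) = pi a g) →
        ∀ a, ((t : ℂ) • X) (Lam a) = pi a ((t : ℂ) • g) := fun hX a => by
      rw [smul_apply, hX, map_smul]
    obtain ⟨z, Q, T, U, hQ, hQn, hTc, hT, hTz, hUc, hU, hUz⟩ :=
      exists_common_dilation Lam pi hstar hnd (hb hR) (hb hS) (hcomm (hb hR)) (hcomm (hb hS))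
        (hlt hRn) (hlt hSn)
    refine le_trans (ENNReal.ofReal_le_ofReal ?_) (le_hilbertWeight hQ hQn)
    have h1 := re_inner_contraction_le hx0 (hxM T hTc) hT z
    have h2 := re_inner_contraction_le hy0 (hyM U hUc) hU z
    have hsc : ∀ (w : H →L[ℂ] H) (g : H),
        (⟪w ((t : ℂ) • g), (t : ℂ) • g⟫_ℂ).re = t ^ 2 * (⟪w g, g⟫_ℂ).re := fun w g => by
      rw [map_smul, inner_smul_left, inner_smul_right, Complex.conj_ofReal,
        Complex.re_ofReal_mul, Complex.re_ofReal_mul]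
      ring
    rw [hTz, hsc] at h1
    rw [hUz, hsc] at h2
    rw [add_apply, inner_add_left, Complex.add_re, mul_add]
    exact add_le_add h1 h2
  have hlim : Tendsto (fun t : ℝ => ENNReal.ofReal
      (t ^ 2 * ((⟪x e, e⟫_ℂ).re + (⟪y f, f⟫_ℂ).re))) (𝓝[<] 1)
      (𝓝 (ENNReal.ofReal ((⟪x e, e⟫_ℂ).re + (⟪y f, f⟫_ℂ).re))) := by
    refine tendsto_nhdsWithin_of_tendsto_nhds (ENNReal.tendsto_ofReal ?_)
    exact Continuous.tendsto' (by fun_prop) _ _ (by ring)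
  exact le_of_tendsto hlim (mem_of_superset (Ioo_mem_nhdsLT zero_lt_one) scaled)
end
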